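/- Fix n ≥ 1 and ρ ∈ [0,1]. Let X = (X₁,…,X_n) and Z = (Z₁,…,Z_n) be independent standard Gaussian vectors in ℝⁿ (all coordinates i.i.d. standard Gaussians), and set Y = ρ·X + √(1−ρ²)·Z, so that (X,Y) is a pair of ρ-correlated standard Gaussian vectors. Then for every Borel measurable set A ⊆ ℝⁿ with standard Gaussian measure γ_n(A) = 1/2, and for the halfspace H = { x ∈ ℝⁿ : x₁ ≤ 0 }, we have Pr[ X ∈ A and Y ∈ A ] ≤ Pr[ X ∈ H and Y ∈ H ]. -/

import Mathlib

open MeasureTheory ProbabilityTheory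

/-- The standard Gaussian measure on `ℝⁿ`. -/
noncomputable def stdGaussian (n : ℕ) : Measure (Fin n → ℝ) :=
  Measure.pi fun _ : Fin n => gaussianReal 0 1

namespace Bor
open Set

lemma taylor_aux {E : Type*} [NormedAddCommGroup E] [NormedSpace ℝ E] {f : E → ℝ} {U S : Set E}
    (hU : IsOpen U) (hf : ContDiffOn ℝ 2 f U) (hSU : S ⊆ U) (hS : IsCompact S)
    (hc : Convex ℝ S) : ∃ C : ℝ, 0 ≤ C ∧ (∀ z ∈ S, ‖fderiv ℝ f z‖ ≤ C) ∧
      ∀ z ∈ S, ∀ z0 ∈ S, ‖f z - f z0 - fderiv ℝ f z0 (z - z0)‖ ≤ C * ‖z - z0‖ ^ 2 := by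
  have h1 : ContDiffOn ℝ 1 (fderiv ℝ f) U := hf.fderiv_of_isOpen hU (by norm_num)
  have h2 : ContDiffOn ℝ 0 (fderiv ℝ (fderiv ℝ f)) U := h1.fderiv_of_isOpen hU (by norm_num)
  obtain ⟨C1, hC1⟩ := hS.exists_bound_of_continuousOn (h1.continuousOn.mono hSU)
  obtain ⟨C2, hC2⟩ := hS.exists_bound_of_continuousOn (E := E →L[ℝ] E →L[ℝ] ℝ) (h2.continuousOn.mono hSU)
  refine ⟨max 0 (max C1 C2), le_max_left _ _, fun z hz => (hC1 z hz).trans (by simp), ?_⟩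
  intro z hz z0 hz0
  have hC2' : C2 ≤ max 0 (max C1 C2) := by simp
  set C := max 0 (max C1 C2)
  have hC0 : 0 ≤ C := le_max_left _ _
  have hseg : segment ℝ z0 z ⊆ S := hc.segment_subset hz0 hz
  have key := (convex_segment z0 z).norm_image_sub_le_of_norm_hasFDerivWithin_le' (𝕜 := ℝ) (f := f)
    (f' := fderiv ℝ f) (φ := fderiv ℝ f z0) (C := C * ‖z - z0‖)
    (fun x hx => ((hf.differentiableOn (by norm_num)).differentiableAt
      (hU.mem_nhds (hSU (hseg hx)))).hasFDerivAt.hasFDerivWithinAt) ?_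
    (left_mem_segment ℝ z0 z) (right_mem_segment ℝ z0 z)
  · rw [pow_two, ← mul_assoc]; exact key
  · intro x hx
    have := hc.norm_image_sub_le_of_norm_fderiv_le (𝕜 := ℝ) (f := fderiv ℝ f) (C := C)
      (fun y hy => (h1.differentiableOn (by norm_num)).differentiableAt (hU.mem_nhds (hSU hy)))
      (fun y hy => (hC2 y hy).trans hC2') hz0 (hseg hx)
    refine this.trans (mul_le_mul_of_nonneg_left ?_ hC0)
    exact norm_sub_le_of_mem_segment hx

noncomputable abbrev γ : Measure ℝ := gaussianReal 0 1
noncomputable abbrev ph : ℝ → ℝ := gaussianPDFReal 0 1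
noncomputable def Ph (s : ℝ) : ℝ := γ.real (Iic s)
noncomputable def Q : ℝ → ℝ := Function.invFun Ph

lemma ph_contDiff : ContDiff ℝ ⊤ ph := by
  unfold ph; rw [gaussianPDFReal_def]; fun_prop

lemma ph_pos (s : ℝ) : 0 < ph s := gaussianPDFReal_pos _ _ _ (by norm_num)

lemma int_Iic (g : ℝ → ℝ) (s : ℝ) : ∫ x in Iic s, g x ∂γ = ∫ x in Iic s, ph x * g x := by
  rw [← integral_indicator measurableSet_Iic, ← integral_indicator measurableSet_Iic,
    integral_gaussianReal_eq_integral_smul (by norm_num)]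
  congr 1; ext x
  by_cases hx : x ∈ Iic s <;> simp [hx]

lemma hasDerivAt_Iic (g : ℝ → ℝ) (hg : Continuous g) (hb : ∀ x, |g x| ≤ 1) (s : ℝ) :
    HasDerivAt (fun s => ∫ x in Iic s, g x ∂γ) (ph s * g s) s := by
  simp_rw [int_Iic]
  have hcont : Continuous (fun x => ph x * g x) := ph_contDiff.continuous.mul hg
  have hint : Integrable (fun x => ph x * g x) := by
    refine (integrable_gaussianPDFReal 0 1).mono' hcont.aestronglyMeasurable (.of_forall fun x => ?_)
    rw [norm_mul, Real.norm_of_nonneg (ph_pos x).le]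
    exact mul_le_of_le_one_right (ph_pos x).le (hb x)
  have : (fun s => ∫ x in Iic s, ph x * g x) =
      fun s => (∫ x in Iic 0, ph x * g x) + ∫ x in (0:ℝ)..s, ph x * g x := by
    ext s
    rw [← intervalIntegral.integral_Iic_sub_Iic hint.integrableOn hint.integrableOn]; ring
  rw [this]
  exact (intervalIntegral.integral_hasDerivAt_right (hcont.intervalIntegrable _ _)
    hcont.aestronglyMeasurable.stronglyMeasurableAtFilter hcont.continuousAt).const_add _

lemma Ph_hasDerivAt (s : ℝ) : HasDerivAt Ph (ph s) s := by
  have := hasDerivAt_Iic (fun _ => 1) continuous_const (by simp) s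
  simp at this; exact this

lemma Ph_nonneg (s : ℝ) : 0 ≤ Ph s := measureReal_nonneg
lemma Ph_le_one (s : ℝ) : Ph s ≤ 1 := measureReal_le_one

lemma Ph_deriv : deriv Ph = ph := funext fun s => (Ph_hasDerivAt s).deriv
lemma Ph_contDiff : ContDiff ℝ 3 Ph := by
  have : (3 : WithTop ℕ∞) = 2 + 1 := by norm_num
  rw [this, contDiff_succ_iff_deriv]
  refine ⟨fun s => (Ph_hasDerivAt s).differentiableAt, by simp, ?_⟩
  rw [Ph_deriv]; exact ph_contDiff.of_le le_top

lemma Ph_strictMono : StrictMono Ph := strictMono_of_deriv_pos fun s => by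
  rw [Ph_deriv]; exact ph_pos s

lemma Ph_mem (s : ℝ) : Ph s ∈ Ioo (0:ℝ) 1 :=
  ⟨(Ph_nonneg (s-1)).trans_lt (Ph_strictMono (by linarith)),
   (Ph_strictMono (by linarith : s < s + 1)).trans_le (Ph_le_one _)⟩

lemma Ph_Q {x : ℝ} (hx : x ∈ Ioo (0:ℝ) 1) : Ph (Q x) = x := by
  have hcdf : Ph = fun s => cdf γ s := by ext s; rw [cdf_eq_real]; rfl
  have h0 := tendsto_cdf_atBot γ
  have h1 := tendsto_cdf_atTop γ
  apply Function.invFun_eq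
  obtain ⟨a, ha⟩ := (h0.eventually (gt_mem_nhds hx.1)).exists
  obtain ⟨b, hb⟩ := (h1.eventually (lt_mem_nhds hx.2)).exists
  have := mem_range_of_exists_le_of_exists_ge (f := Ph) (c := x) Ph_contDiff.continuous
    ⟨a, by rw [hcdf]; exact ha.le⟩ ⟨b, by rw [hcdf]; exact hb.le⟩
  exact this

lemma Q_Ph (s : ℝ) : Q (Ph s) = s := Function.leftInverse_invFun Ph_strictMono.injective s

noncomputable def PhH : OpenPartialHomeomorph ℝ ℝ where
  toFun := Ph
  invFun := Q
  source := univ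
  target := Ioo 0 1
  map_source' s _ := Ph_mem s
  map_target' _ _ := mem_univ _
  left_inv' s _ := Q_Ph s
  right_inv' _ hx := Ph_Q hx
  open_source := isOpen_univ
  open_target := isOpen_Ioo
  continuousOn_toFun := Ph_contDiff.continuous.continuousOn
  continuousOn_invFun := by
    have hm : StrictMonoOn Q (Ioo 0 1) := fun x hx y hy h => by
      rw [← Ph_Q hx, ← Ph_Q hy] at h; exact Ph_strictMono.lt_iff_lt.1 h
    have himg : Q '' (Ioo 0 1) = univ := by
      ext s; simp only [mem_univ, iff_true]; exact ⟨Ph s, Ph_mem s, Q_Ph s⟩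
    intro x hx
    refine (hm.continuousAt_of_image_mem_nhds (isOpen_Ioo.mem_nhds hx) ?_).continuousWithinAt
    rw [himg]; exact Filter.univ_mem

lemma Q_contDiffAt {x : ℝ} (hx : x ∈ Ioo (0:ℝ) 1) : ContDiffAt ℝ 3 Q x :=
  PhH.contDiffAt_symm_deriv (f₀' := ph (Q x)) (ph_pos _).ne' hx (Ph_hasDerivAt _)
    Ph_contDiff.contDiffAt

lemma Q_hasDerivAt {x : ℝ} (hx : x ∈ Ioo (0:ℝ) 1) : HasDerivAt Q (ph (Q x))⁻¹ x :=
  PhH.hasDerivAt_symm hx (ph_pos _).ne' (Ph_hasDerivAt _)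

lemma rot {V : Type*} [NormedAddCommGroup V] [NormedSpace ℝ V] [MeasurableSpace V]
    [BorelSpace V] [SecondCountableTopology V] [CompleteSpace V] (μ : Measure V) [IsGaussian μ]
    (hμ : μ[id] = 0) (α β : ℝ) (h : α ^ 2 + β ^ 2 = 1) :
    MeasurePreserving (fun p : V × V => (α • p.1 + β • p.2, -β • p.1 + α • p.2))
      (μ.prod μ) (μ.prod μ) := by
  refine ⟨by fun_prop, ?_⟩
  have h2 : α * α + β * β = 1 := by nlinarith
  obtain ⟨θ, hα, hβ⟩ : ∃ θ, α = Real.cos θ ∧ β = Real.sin θ := by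
    let z : ℂ := ⟨α, β⟩
    have hz : ‖z‖ = 1 := by
      rw [Complex.norm_def, Complex.normSq_mk, h2, Real.sqrt_one]
    refine ⟨Complex.arg z, ?_, ?_⟩
    · have := Complex.norm_mul_cos_arg z
      rw [hz, one_mul] at this; rw [this]
    · have := Complex.norm_mul_sin_arg z
      rw [hz, one_mul] at this; rw [this]
  have := IsGaussian.map_rotation_eq_self (μ := μ) hμ θ
  convert this using 2
  ext p <;> simp [hα, hβ, ContinuousLinearMap.rotation_apply]

end Bor

namespace Bor
open Set

noncomputable def KK (ρ σ s t : ℝ) : ℝ := (γ.prod γ).real {p | p.1 ≤ s ∧ ρ * p.1 + σ * p.2 ≤ t}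

lemma meas_set (ρ σ s t : ℝ) :
    MeasurableSet {p : ℝ × ℝ | p.1 ≤ s ∧ ρ * p.1 + σ * p.2 ≤ t} := by
  rw [ofPred_and]
  exact (measurableSet_le (by fun_prop) (by fun_prop)).inter
    (measurableSet_le (by fun_prop) (by fun_prop))

lemma KK_eq (ρ σ s t : ℝ) (hσ : 0 < σ) :
    KK ρ σ s t = ∫ x in Iic s, Ph ((t - ρ * x) / σ) ∂γ := by
  have hm : MeasurableSet {p : ℝ × ℝ | p.1 ≤ s ∧ ρ * p.1 + σ * p.2 ≤ t} :=
    meas_set ρ σ s t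
  rw [KK, measureReal_def, Measure.prod_apply hm, ← integral_toReal
    (measurable_measure_prodMk_left hm).aemeasurable (.of_forall fun x => measure_lt_top _ _),
    ← integral_indicator measurableSet_Iic]
  congr 1; ext x
  by_cases hx : x ≤ s
  · have : Prod.mk x ⁻¹' {p : ℝ × ℝ | p.1 ≤ s ∧ ρ * p.1 + σ * p.2 ≤ t} = Iic ((t - ρ * x) / σ) := by
      ext z; simp [hx, le_div_iff₀ hσ]; constructor <;> intro h <;> linarith
    rw [this, indicator_of_mem (show x ∈ Iic s from hx)]; rfl
  · have : Prod.mk x ⁻¹' {p : ℝ × ℝ | p.1 ≤ s ∧ ρ * p.1 + σ * p.2 ≤ t} = ∅ := by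
      ext z; simp [hx]
    rw [this, indicator_of_notMem (show x ∉ Iic s from hx)]; simp

lemma KK_symm (ρ σ s t : ℝ) (h : ρ ^ 2 + σ ^ 2 = 1) : KK ρ σ s t = KK ρ σ t s := by
  have hm : ∀ s t, MeasurableSet {p : ℝ × ℝ | p.1 ≤ s ∧ ρ * p.1 + σ * p.2 ≤ t} := fun s t =>
    meas_set ρ σ s t
  have hneg : MeasurePreserving (fun x : ℝ => -x) γ γ :=
    ⟨by fun_prop, by rw [gaussianReal_map_neg]; simp⟩
  have hT := ((MeasurePreserving.id γ).prod hneg).comp (rot γ (by simp) ρ σ h)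
  have := hT.measureReal_preimage (hm s t).nullMeasurableSet
  rw [KK, ← this, KK]
  congr 1; ext p
  simp
  have : ρ * (ρ * p.1 + σ * p.2) + σ * (-(ρ * p.2) + σ * p.1) = p.1 := by
    linear_combination p.1 * h
  rw [this]; tauto

lemma KK_hasDerivAt (ρ σ s t : ℝ) (hσ : 0 < σ) :
    HasDerivAt (fun s => KK ρ σ s t) (ph s * Ph ((t - ρ * s) / σ)) s := by
  simp_rw [KK_eq _ _ _ _ hσ]
  refine hasDerivAt_Iic (fun x => Ph ((t - ρ * x) / σ)) ?_ ?_ s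
  · exact Ph_contDiff.continuous.comp (by fun_prop)
  · intro x; rw [abs_of_nonneg (Ph_nonneg _)]; exact Ph_le_one _

noncomputable def J (ρ σ x y : ℝ) : ℝ := KK ρ σ (Q x) (Q y)
noncomputable def J1 (ρ σ : ℝ) (z : ℝ × ℝ) : ℝ := Ph ((Q z.2 - ρ * Q z.1) / σ)

lemma J_symm (ρ σ x y : ℝ) (h : ρ ^ 2 + σ ^ 2 = 1) : J ρ σ x y = J ρ σ y x := KK_symm _ _ _ _ h

lemma J_hasDerivAt {ρ σ x : ℝ} (y : ℝ) (hσ : 0 < σ) (hx : x ∈ Ioo (0:ℝ) 1) :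
    HasDerivAt (fun x => J ρ σ x y) (J1 ρ σ (x, y)) x := by
  have := (KK_hasDerivAt ρ σ (Q x) (Q y) hσ).comp x (Q_hasDerivAt hx)
  have e : ph (Q x) * Ph ((Q y - ρ * Q x) / σ) * (ph (Q x))⁻¹ = J1 ρ σ (x, y) := by
    have := (ph_pos (Q x)).ne'
    simp only [J1]; field_simp
  rw [e] at this
  exact this

lemma J_hasDerivAt' {ρ σ y : ℝ} (x : ℝ) (hσ : 0 < σ) (h : ρ ^ 2 + σ ^ 2 = 1)
    (hy : y ∈ Ioo (0:ℝ) 1) :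
    HasDerivAt (fun y => J ρ σ x y) (J1 ρ σ (y, x)) y := by
  simp_rw [J_symm ρ σ x _ h]; exact J_hasDerivAt x hσ hy

lemma J_nonneg (ρ σ x y : ℝ) : 0 ≤ J ρ σ x y := measureReal_nonneg
lemma J_le_one (ρ σ x y : ℝ) : J ρ σ x y ≤ 1 := measureReal_le_one

lemma J1_abs (ρ σ : ℝ) (z) : |J1 ρ σ z| ≤ 1 := by
  rw [J1, abs_of_nonneg (Ph_nonneg _)]; exact Ph_le_one _

lemma J_lip {ρ σ : ℝ} (hσ : 0 < σ) (h : ρ ^ 2 + σ ^ 2 = 1) {x y x' y' : ℝ}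
    (hx : x ∈ Ioo (0:ℝ) 1) (hy : y ∈ Ioo (0:ℝ) 1) (hx' : x' ∈ Ioo (0:ℝ) 1)
    (hy' : y' ∈ Ioo (0:ℝ) 1) : |J ρ σ x y - J ρ σ x' y'| ≤ |x - x'| + |y - y'| := by
  have h1 := (convex_Ioo (0:ℝ) 1).norm_image_sub_le_of_norm_hasDerivWithin_le
    (f := fun x => J ρ σ x y) (f' := fun x => J1 ρ σ (x, y)) (C := 1)
    (fun x hx => (J_hasDerivAt y hσ hx).hasDerivWithinAt) (fun _ _ => J1_abs _ _ _) hx' hx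
  have h2 := (convex_Ioo (0:ℝ) 1).norm_image_sub_le_of_norm_hasDerivWithin_le
    (f := fun y => J ρ σ x' y) (f' := fun y => J1 ρ σ (y, x')) (C := 1)
    (fun y hy => (J_hasDerivAt' x' hσ h hy).hasDerivWithinAt) (fun _ _ => J1_abs _ _ _) hy' hy
  simp only [Real.norm_eq_abs, one_mul] at h1 h2
  calc _ = |(J ρ σ x y - J ρ σ x' y) + (J ρ σ x' y - J ρ σ x' y')| := by ring_nf
    _ ≤ _ := (abs_add_le _ _).trans (add_le_add h1 h2)

lemma J_continuousOn {ρ σ : ℝ} (hσ : 0 < σ) (h : ρ ^ 2 + σ ^ 2 = 1) :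
    ContinuousOn (fun z : ℝ × ℝ => J ρ σ z.1 z.2) (Ioo (0:ℝ) 1 ×ˢ Ioo (0:ℝ) 1) := by
  have : LipschitzOnWith 2 (fun z : ℝ × ℝ => J ρ σ z.1 z.2) (Ioo (0:ℝ) 1 ×ˢ Ioo (0:ℝ) 1) := by
    refine LipschitzOnWith.of_dist_le_mul fun z hz w hw => ?_
    have := J_lip hσ h hz.1 hz.2 hw.1 hw.2
    rw [Real.dist_eq, Prod.dist_eq, Real.dist_eq, Real.dist_eq]
    refine this.trans ?_
    have h1 := le_max_left |z.1 - w.1| |z.2 - w.2|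
    have h2 := le_max_right |z.1 - w.1| |z.2 - w.2|
    push_cast; linarith
  exact this.continuousOn

lemma meas_Q {x : ℝ} (hx : x ∈ Ioo (0:ℝ) 1) : γ.real (Iic (Q x)) = x := Ph_Q hx

lemma J_ge {ρ σ : ℝ} (h : ρ ^ 2 + σ ^ 2 = 1) {x y : ℝ}
    (hx : x ∈ Ioo (0:ℝ) 1) (hy : y ∈ Ioo (0:ℝ) 1) : x + y - 1 ≤ J ρ σ x y := by
  have hA : (γ.prod γ).real {p | p.1 ≤ Q x} = x := by
    have := (measurePreserving_fst (μ := γ) (ν := γ)).measureReal_preimage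
      (measurableSet_Iic (a := Q x)).nullMeasurableSet
    rw [meas_Q hx] at this; exact this
  have hB : (γ.prod γ).real {p | ρ * p.1 + σ * p.2 ≤ Q y} = y := by
    have := ((measurePreserving_fst (μ := γ) (ν := γ)).comp
      (rot γ (by simp) ρ σ h)).measureReal_preimage
      (measurableSet_Iic (a := Q y)).nullMeasurableSet
    rw [meas_Q hy] at this; exact this
  have hmB : MeasurableSet {p : ℝ × ℝ | ρ * p.1 + σ * p.2 ≤ Q y} :=
    measurableSet_le (by fun_prop) (by fun_prop)
  have := measureReal_union_add_inter (μ := γ.prod γ) (s := {p | p.1 ≤ Q x})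
    (t := {p | ρ * p.1 + σ * p.2 ≤ Q y}) hmB
  rw [hA, hB] at this
  have h1 : (γ.prod γ).real ({p | p.1 ≤ Q x} ∪ {p | ρ * p.1 + σ * p.2 ≤ Q y}) ≤ 1 :=
    measureReal_le_one
  have h2 : J ρ σ x y = (γ.prod γ).real ({p | p.1 ≤ Q x} ∩ {p | ρ * p.1 + σ * p.2 ≤ Q y}) := rfl
  linarith

lemma Ph_zero : Ph 0 = 1 / 2 := by
  have hneg : MeasurePreserving (fun x : ℝ => -x) γ γ :=
    ⟨by fun_prop, by rw [gaussianReal_map_neg]; simp⟩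
  have h1 : γ.real (Ici 0) = γ.real (Iic 0) := by
    have := hneg.measureReal_preimage (measurableSet_Iic (a := (0:ℝ))).nullMeasurableSet
    rw [← this]; congr 1; ext; simp
  have : NullSingletonClass γ := nullSingletonClass_gaussianReal (by norm_num)
  have h2 : γ.real (Ioi 0) = γ.real (Ici 0) := by
    simp only [measureReal_def]; rw [measure_congr Ioi_ae_eq_Ici]
  have h3 := probReal_add_probReal_compl (μ := γ) (measurableSet_Iic (a := (0:ℝ)))
  rw [compl_Iic, h2, h1] at h3
  rw [Ph]; linarith

lemma J_half (ρ σ : ℝ) : J ρ σ (1/2) (1/2) = KK ρ σ 0 0 := by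
  rw [J, ← Ph_zero, Q_Ph]

end Bor

namespace Bor
open Set

lemma ph_ident {ρ σ : ℝ} (hσ : 0 < σ) (h : ρ ^ 2 + σ ^ 2 = 1) (s t : ℝ) :
    ph ((t - ρ * s) / σ) * ph s = ph ((s - ρ * t) / σ) * ph t := by
  simp only [ph, gaussianPDFReal]
  rw [mul_mul_mul_comm, mul_mul_mul_comm _ (Real.exp _), ← Real.exp_add, ← Real.exp_add]
  congr 2
  have : σ ≠ 0 := hσ.ne'
  have h2 : σ ^ 2 = 1 - ρ ^ 2 := by linarith
  push_cast
  field_simp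
  rw [h2]; ring

lemma J1_hasFDerivAt (ρ σ : ℝ) {a c : ℝ} (ha : a ∈ Ioo (0:ℝ) 1)
    (hc : c ∈ Ioo (0:ℝ) 1) :
    HasFDerivAt (J1 ρ σ)
      ((-(ρ / σ * ph ((Q c - ρ * Q a) / σ) / ph (Q a))) • ContinuousLinearMap.fst ℝ ℝ ℝ +
       (ph ((Q c - ρ * Q a) / σ) / (σ * ph (Q c))) • ContinuousLinearMap.snd ℝ ℝ ℝ) (a, c) := by
  have h1 : HasFDerivAt (fun z : ℝ × ℝ => Q z.1) ((ph (Q a))⁻¹ • ContinuousLinearMap.fst ℝ ℝ ℝ) (a, c) :=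
    HasDerivAt.comp_hasFDerivAt (a, c) (h₂ := Q) (f := fun z : ℝ × ℝ => z.1) (Q_hasDerivAt ha) hasFDerivAt_fst
  have h2 : HasFDerivAt (fun z : ℝ × ℝ => Q z.2) ((ph (Q c))⁻¹ • ContinuousLinearMap.snd ℝ ℝ ℝ) (a, c) :=
    HasDerivAt.comp_hasFDerivAt (a, c) (h₂ := Q) (f := fun z : ℝ × ℝ => z.2) (Q_hasDerivAt hc) hasFDerivAt_snd
  have h3 := (h2.sub (h1.const_mul ρ)).mul_const σ⁻¹
  have h4 := HasDerivAt.comp_hasFDerivAt (a, c) (h₂ := Ph)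
    (f := fun z : ℝ × ℝ => (Q z.2 - ρ * Q z.1) * σ⁻¹) (Ph_hasDerivAt _) h3
  have h5 : HasFDerivAt (J1 ρ σ) _ (a, c) := h4
  refine h5.congr_fderiv ?_
  ext <;> simp [div_eq_mul_inv] <;> ring_nf <;> simp

lemma J1_contDiffOn (ρ σ : ℝ) : ContDiffOn ℝ 2 (J1 ρ σ) (Ioo (0:ℝ) 1 ×ˢ Ioo (0:ℝ) 1) := by
  intro z hz
  have h1 : ContDiffAt ℝ 2 (fun z : ℝ × ℝ => Q z.1) z :=
    ((Q_contDiffAt hz.1).of_le (by norm_num)).comp z contDiffAt_fst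
  have h2 : ContDiffAt ℝ 2 (fun z : ℝ × ℝ => Q z.2) z :=
    ((Q_contDiffAt hz.2).of_le (by norm_num)).comp z contDiffAt_snd
  have h3 : ContDiffAt ℝ 2 (fun z : ℝ × ℝ => (Q z.2 - ρ * Q z.1) / σ) z :=
    (h2.sub (contDiffAt_const.mul h1)).div_const σ
  exact ((Ph_contDiff.of_le (by norm_num)).contDiffAt.comp z h3).contDiffWithinAt

lemma J_taylor {ρ σ : ℝ} (hρ : 0 ≤ ρ) (hσ : 0 < σ) (h : ρ ^ 2 + σ ^ 2 = 1) {ε : ℝ} (hε : 0 < ε) :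
    ∃ C : ℝ, 0 ≤ C ∧ ∀ a ∈ Icc ε (1 - ε), ∀ c ∈ Icc ε (1 - ε), ∃ A B D E H : ℝ,
      |D| ≤ C ∧ |E| ≤ C ∧ |H| ≤ C ∧ (∀ u v : ℝ, D * u ^ 2 + 2 * ρ * E * (u * v) + H * v ^ 2 ≤ 0) ∧
      ∀ x ∈ Icc ε (1 - ε), ∀ y ∈ Icc ε (1 - ε),
        J ρ σ x y ≤ J ρ σ a c + A * (x - a) + B * (y - c) +
          (D * (x - a) ^ 2 + 2 * E * ((x - a) * (y - c)) + H * (y - c) ^ 2) +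
          C * (|x - a| + |y - c|) ^ 3 := by
  have hS : Icc ε (1 - ε) ⊆ Ioo (0:ℝ) 1 := fun x hx => ⟨by linarith [hx.1], by linarith [hx.2]⟩
  obtain ⟨C, hC, hb, hT⟩ := taylor_aux (isOpen_Ioo.prod isOpen_Ioo) (J1_contDiffOn ρ σ)
    (prod_mono hS hS) (isCompact_Icc.prod isCompact_Icc) ((convex_Icc _ _).prod (convex_Icc _ _))
  refine ⟨2 * C, by positivity, fun a ha c hc => ?_⟩
  have hqa := ph_pos (Q a)
  have hqc := ph_pos (Q c)
  have hid := ph_ident hσ h (Q a) (Q c)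
  set w := ph ((Q c - ρ * Q a) / σ) with hw
  set w' := ph ((Q a - ρ * Q c) / σ) with hw'
  have hwp : 0 < w := ph_pos _
  have hF1 := (J1_hasFDerivAt ρ σ (hS ha) (hS hc)).fderiv
  have hF2 := (J1_hasFDerivAt ρ σ (hS hc) (hS ha)).fderiv
  rw [← hw] at hF1
  rw [← hw'] at hF2
  have hE : w' / (σ * ph (Q a)) = w / (σ * ph (Q c)) := by
    rw [div_eq_div_iff (by positivity) (by positivity)]
    linear_combination -σ * hid
  have hw'e : w' = w * ph (Q a) / ph (Q c) := by
    rw [eq_div_iff hqc.ne']; exact hid.symm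
  rw [hE] at hF2
  set D := -(ρ / σ * w / ph (Q a)) with hD
  set E := w / (σ * ph (Q c)) with hEd
  set H := -(ρ / σ * w' / ph (Q c)) with hH
  have bnd : ∀ z ∈ Icc ε (1 - ε) ×ˢ Icc ε (1 - ε), ∀ d e : ℝ, fderiv ℝ (J1 ρ σ) z =
      d • ContinuousLinearMap.fst ℝ ℝ ℝ + e • ContinuousLinearMap.snd ℝ ℝ ℝ → |d| ≤ C ∧ |e| ≤ C := by
    intro z hz d e hde
    have hn := hb z hz
    rw [hde] at hn
    have h1 := ContinuousLinearMap.le_of_opNorm_le _ hn ((1, 0) : ℝ × ℝ)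
    have h2 := ContinuousLinearMap.le_of_opNorm_le _ hn ((0, 1) : ℝ × ℝ)
    simp [Prod.norm_def] at h1 h2
    exact ⟨h1, h2⟩
  obtain ⟨b1, b2⟩ := bnd (a, c) ⟨ha, hc⟩ _ _ hF1
  obtain ⟨b3, -⟩ := bnd (c, a) ⟨hc, ha⟩ _ _ hF2
  have T1 : ∀ x ∈ Icc ε (1 - ε), ∀ y ∈ Icc ε (1 - ε),
      |J1 ρ σ (x, y) - J1 ρ σ (a, c) - (D * (x - a) + E * (y - c))| ≤ C * (|x - a| + |y - c|) ^ 2 := by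
    intro x hx y hy
    have := hT (x, y) ⟨hx, hy⟩ (a, c) ⟨ha, hc⟩
    rw [hF1] at this
    simp [Prod.norm_def] at this
    refine this.trans ?_
    gcongr
    exact max_le (by linarith [abs_nonneg (y - c)]) (by linarith [abs_nonneg (x - a)])
  have T2 : ∀ y ∈ Icc ε (1 - ε),
      |J1 ρ σ (y, a) - J1 ρ σ (c, a) - H * (y - c)| ≤ C * |y - c| ^ 2 := by
    intro y hy
    have := hT (y, a) ⟨hy, ha⟩ (c, a) ⟨hc, ha⟩
    rw [hF2] at this
    simp [Prod.norm_def] at this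
    rw [sq_abs]; exact this
  refine ⟨J1 ρ σ (a, c), J1 ρ σ (c, a), D / 2, E / 2, H / 2, ?_, ?_, ?_, ?_, ?_⟩
  · rw [abs_div, abs_two]; linarith [abs_nonneg D]
  · rw [abs_div, abs_two]; linarith [abs_nonneg E]
  · rw [abs_div, abs_two]; linarith [abs_nonneg H]
  · intro u v
    have : D / 2 * u ^ 2 + 2 * ρ * (E / 2) * (u * v) + H / 2 * v ^ 2 =
      -(ρ * w * ph (Q a) / (2 * σ) * (u / ph (Q a) - v / ph (Q c)) ^ 2) := by
      rw [hD, hEd, hH, hw'e]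
      field_simp
      ring
    rw [this]
    have : 0 ≤ ρ * w * ph (Q a) / (2 * σ) * (u / ph (Q a) - v / ph (Q c)) ^ 2 := by positivity
    linarith
  · intro x hx y hy
    have hxs : uIcc a x ⊆ Icc ε (1 - ε) := ordConnected_Icc.uIcc_subset ha hx
    have hys : uIcc c y ⊆ Icc ε (1 - ε) := ordConnected_Icc.uIcc_subset hc hy
    have m1 := (convex_uIcc a x).norm_image_sub_le_of_norm_hasDerivWithin_le
      (f := fun x => J ρ σ x y - J1 ρ σ (a, c) * (x - a) - D / 2 * (x - a) ^ 2 - E * ((x - a) * (y - c)))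
      (f' := fun x => J1 ρ σ (x, y) - J1 ρ σ (a, c) - (D * (x - a) + E * (y - c)))
      (C := C * (|x - a| + |y - c|) ^ 2) ?_ ?_ left_mem_uIcc right_mem_uIcc
    rotate_left
    · intro x hx
      have hi : HasDerivAt (fun x : ℝ => x - a) 1 x := (hasDerivAt_id x).sub_const a
      have := (((J_hasDerivAt (ρ := ρ) y hσ (hS (hxs hx))).sub (hi.const_mul (J1 ρ σ (a, c)))).sub
        ((hi.pow 2).const_mul (D / 2))).sub ((hi.mul_const (y - c)).const_mul E)
      refine HasDerivAt.hasDerivWithinAt ?_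
      refine HasDerivAt.congr_deriv (this : HasDerivAt _ _ _) ?_
      simp; ring
    · intro z hz
      refine (T1 z (hxs hz) y hy).trans ?_
      have := abs_sub_left_of_mem_uIcc hz
      gcongr C * ?_
      exact pow_le_pow_left₀ (by positivity) (by linarith) 2
    have m2 := (convex_uIcc c y).norm_image_sub_le_of_norm_hasDerivWithin_le
      (f := fun y => J ρ σ a y - J1 ρ σ (c, a) * (y - c) - H / 2 * (y - c) ^ 2)
      (f' := fun y => J1 ρ σ (y, a) - J1 ρ σ (c, a) - H * (y - c))
      (C := C * |y - c| ^ 2) ?_ ?_ left_mem_uIcc right_mem_uIcc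
    rotate_left
    · intro y hy
      have hi : HasDerivAt (fun y : ℝ => y - c) 1 y := (hasDerivAt_id y).sub_const c
      have := ((J_hasDerivAt' (ρ := ρ) a hσ h (hS (hys hy))).sub (hi.const_mul (J1 ρ σ (c, a)))).sub
        ((hi.pow 2).const_mul (H / 2))
      refine HasDerivAt.hasDerivWithinAt ?_
      refine HasDerivAt.congr_deriv (this : HasDerivAt _ _ _) ?_
      simp; ring
    · intro z hz
      refine (T2 z (hys hz)).trans ?_
      have := abs_sub_left_of_mem_uIcc hz
      gcongr C * ?_
      exact pow_le_pow_left₀ (by positivity) (by linarith) 2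
    simp only [Real.norm_eq_abs] at m1 m2
    have m1' := (le_abs_self _).trans m1
    have m2' := (le_abs_self _).trans m2
    have e1 : C * (|x - a| + |y - c|) ^ 2 * |x - a| ≤ C * (|x - a| + |y - c|) ^ 2 * (|x - a| + |y - c|) := by
      gcongr; linarith [abs_nonneg (y - c)]
    have e2 : C * |y - c| ^ 2 * |y - c| ≤ C * (|x - a| + |y - c|) ^ 2 * (|x - a| + |y - c|) := by
      have : |y - c| ≤ |x - a| + |y - c| := by linarith [abs_nonneg (x - a)]
      gcongr
    have e3 : 2 * C * (|x - a| + |y - c|) ^ 3 = C * (|x - a| + |y - c|) ^ 2 * (|x - a| + |y - c|) + C * (|x - a| + |y - c|) ^ 2 * (|x - a| + |y - c|) := by ring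
    rw [e3]
    simp only [sub_self] at m1' m2'
    linarith

end Bor

namespace Bor
open Set

section arith

lemma arith_step {C K r N D E H u v p q R1 R2 : ℝ} (hC : 0 ≤ C) (hK : 0 ≤ K) (hr : 0 ≤ r)
    (hr1 : r ≤ 1) (hN : 1 ≤ N) (hD : |D| ≤ C) (hE : |E| ≤ C) (hH : |H| ≤ C)
    (hu : u = p + R1) (hv : v = q + R2) (hp : |p| ≤ K * r * N) (hq : |q| ≤ K * r * N)
    (h1 : |R1| ≤ K * r ^ 2 * N ^ 2) (h2 : |R2| ≤ K * r ^ 2 * N ^ 2) :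
    (D * u ^ 2 + 2 * E * (u * v) + H * v ^ 2) + C * (|u| + |v|) ^ 3 ≤
      (D * p ^ 2 + 2 * E * (p * q) + H * q ^ 2) + C * (12 * K ^ 2 + 64 * K ^ 3) * r ^ 3 * N ^ 6 := by
  have hN0 : 0 ≤ N := by linarith
  have e1 : K * r * N ≤ K * r * N ^ 2 := by
    have : N ≤ N ^ 2 := by nlinarith
    gcongr
  have e2 : K * r ^ 2 * N ^ 2 ≤ K * r * N ^ 2 := by
    have : r ^ 2 ≤ r := by nlinarith
    gcongr
  have hu' : |u| ≤ 2 * (K * r * N ^ 2) := by rw [hu]; linarith [abs_add_le p R1]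
  have hv' : |v| ≤ 2 * (K * r * N ^ 2) := by rw [hv]; linarith [abs_add_le q R2]
  have hp' : |p| ≤ K * r * N ^ 2 := hp.trans e1
  have hq' : |q| ≤ K * r * N ^ 2 := hq.trans e1
  set T := K * r * N ^ 2 with hT
  have hT0 : 0 ≤ T := by positivity
  set W := K * r ^ 2 * N ^ 2 with hW
  have hW0 : 0 ≤ W := by positivity
  have b1 : |D * (R1 * (u + p))| ≤ C * (W * (3 * T)) := by
    rw [abs_mul, abs_mul]
    have : |u + p| ≤ 3 * T := by linarith [abs_add_le u p]
    gcongr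
  have b2 : |H * (R2 * (v + q))| ≤ C * (W * (3 * T)) := by
    rw [abs_mul, abs_mul]
    have : |v + q| ≤ 3 * T := by linarith [abs_add_le v q]
    gcongr
  have b3 : |E * (R1 * v + p * R2)| ≤ C * (3 * W * T) := by
    rw [abs_mul]
    have : |R1 * v + p * R2| ≤ 3 * W * T := by
      refine (abs_add_le _ _).trans ?_
      rw [abs_mul, abs_mul]
      have i1 : |R1| * |v| ≤ W * (2 * T) := by gcongr
      have i2 : |p| * |R2| ≤ T * W := by gcongr
      linarith
    gcongr
  have b4 : C * (|u| + |v|) ^ 3 ≤ C * (4 * T) ^ 3 := by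
    gcongr; linarith
  have hsum : D * u ^ 2 + 2 * E * (u * v) + H * v ^ 2 = (D * p ^ 2 + 2 * E * (p * q) + H * q ^ 2) +
      D * (R1 * (u + p)) + 2 * (E * (R1 * v + p * R2)) + H * (R2 * (v + q)) := by
    rw [hu, hv]; ring
  have e3 : C * (12 * K ^ 2) * r ^ 3 * N ^ 4 ≤ C * (12 * K ^ 2) * r ^ 3 * N ^ 6 := by
    gcongr
    norm_num
  have e4 : C * (W * (3 * T)) = C * (3 * K ^ 2) * r ^ 3 * N ^ 4 := by rw [hW, hT]; ring
  have e5 : C * (3 * W * T) = C * (3 * K ^ 2) * r ^ 3 * N ^ 4 := by rw [hW, hT]; ring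
  have e6 : C * (4 * T) ^ 3 = C * (64 * K ^ 3) * r ^ 3 * N ^ 6 := by rw [hT]; ring
  rw [hsum]
  have := le_abs_self (D * (R1 * (u + p)))
  have := le_abs_self (E * (R1 * v + p * R2))
  have := le_abs_self (H * (R2 * (v + q)))
  linarith

end arith

variable {V : Type*} [NormedAddCommGroup V] [NormedSpace ℝ V] [MeasurableSpace V]
    [BorelSpace V] [SecondCountableTopology V] [CompleteSpace V]

structure Cl (ε K : ℝ) (F : V → ℝ) : Prop where
  mem : ∀ x, F x ∈ Icc ε (1 - ε)
  cont : Continuous F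
  ex : ∃ L : V → StrongDual ℝ V, Continuous L ∧ (∀ x, ‖L x‖ ≤ K) ∧
    ∀ x u, |F (x + u) - F x - L x u| ≤ K * ‖u‖ ^ 2

noncomputable def Pr (μ : Measure V) (r : ℝ) (F : V → ℝ) (x : V) : ℝ := ∫ y, F (x + r • y) ∂μ

lemma bdd_int {α : Type*} [MeasurableSpace α] [TopologicalSpace α] [OpensMeasurableSpace α]
    {E : Type*} [NormedAddCommGroup E] [SecondCountableTopologyEither α E]
    (μ : Measure α) [IsFiniteMeasure μ] {f : α → E} (hf : Continuous f) {C : ℝ} (h : ∀ x, ‖f x‖ ≤ C) :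
    Integrable f μ :=
  Integrable.of_bound hf.aestronglyMeasurable C (.of_forall h)

lemma Cl.abs_le {ε K : ℝ} {F : V → ℝ} (h : Cl ε K F) (hε : 0 < ε) (x : V) : ‖F x‖ ≤ 1 := by
  have := h.mem x
  rw [Real.norm_eq_abs, abs_of_nonneg] <;> linarith [this.1, this.2]

lemma Cl.Pr {ε K : ℝ} {F : V → ℝ} (h : Cl ε K F) (hε : 0 < ε) (μ : Measure V)
    [IsProbabilityMeasure μ] (r : ℝ) : Cl ε K (Pr μ r F) := by
  obtain ⟨L, hLc, hLK, hL⟩ := h.ex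
  have hFc := h.cont
  have hint : ∀ x, Integrable (fun y => F (x + r • y)) μ := fun x =>
    bdd_int μ (by fun_prop) (fun y => h.abs_le hε _)
  have hLint : ∀ x, Integrable (fun y => L (x + r • y)) μ := fun x =>
    bdd_int μ (by fun_prop) (fun y => hLK _)
  refine ⟨fun x => ⟨?_, ?_⟩, ?_, fun x => ∫ y, L (x + r • y) ∂μ, ?_, ?_, ?_⟩
  · have := integral_mono (μ := μ) (integrable_const ε) (hint x) (fun y => (h.mem _).1)
    simpa [Bor.Pr] using this
  · have := integral_mono (μ := μ) (hint x) (integrable_const (1 - ε)) (fun y => (h.mem _).2)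
    simpa [Bor.Pr] using this
  · exact continuous_of_dominated (fun x => (hint x).aestronglyMeasurable)
      (fun x => .of_forall fun y => h.abs_le hε _) (integrable_const 1)
      (.of_forall fun y => by fun_prop)
  · exact continuous_of_dominated (fun x => (hLint x).aestronglyMeasurable)
      (fun x => .of_forall fun y => hLK _) (integrable_const K)
      (.of_forall fun y => by fun_prop)
  · intro x
    have := norm_integral_le_of_norm_le_const (μ := μ) (f := fun y => L (x + r • y)) (.of_forall fun y => hLK _)
    simpa using this
  · intro x u
    have e : Bor.Pr μ r F (x + u) - Bor.Pr μ r F x - (∫ y, L (x + r • y) ∂μ) u =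
        ∫ y, (F (x + r • y + u) - F (x + r • y) - L (x + r • y) u) ∂μ := by
      have h1 : Integrable (fun y => F (x + r • y + u)) μ := by
        have := hint (x + u)
        simpa [add_right_comm] using this
      have h2 := (hLint x).apply_continuousLinearMap u
      have h12 : Integrable (fun y => F (x + r • y + u) - F (x + r • y)) μ := h1.sub (hint x)
      rw [integral_sub h12 h2, integral_sub h1 (hint x),
        ContinuousLinearMap.integral_apply (hLint x)]
      simp [Bor.Pr, add_right_comm]
    rw [e]
    have := norm_integral_le_of_norm_le_const (μ := μ)
      (f := fun y => (F (x + r • y + u) - F (x + r • y) - L (x + r • y) u))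
      (.of_forall fun y => hL _ _)
    simpa using this

end Bor

namespace Bor
open Set

lemma mp_int {α β : Type*} [MeasurableSpace α] [MeasurableSpace β] [TopologicalSpace β]
    [OpensMeasurableSpace β] {ν : Measure α} {μ : Measure β} {f : α → β}
    (h : MeasurePreserving f ν μ) {g : β → ℝ} (hg : Continuous g) :
    ∫ w, g (f w) ∂ν = ∫ y, g y ∂μ := by
  rw [← h.map_eq, integral_map h.measurable.aemeasurable hg.measurable.aestronglyMeasurable]

section
variable {V : Type*} [NormedAddCommGroup V] [NormedSpace ℝ V] [MeasurableSpace V]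
    [BorelSpace V] [SecondCountableTopology V] [CompleteSpace V]

lemma N6 (μ : Measure V) [IsGaussian μ] : Integrable (fun w => (1 + 2 * ‖w‖) ^ 6) μ := by
  have h1 : MemLp (fun w : V => 1 + 2 * ‖w‖) 6 μ := by
    have h0 : MemLp (fun w : V => ‖w‖) 6 μ := (IsGaussian.memLp_id μ 6 (by simp)).norm
    have h2 : MemLp (fun w : V => 2 * ‖w‖) 6 μ := h0.const_mul 2
    have h3 : MemLp (fun w : V => (1 : ℝ)) 6 μ := memLp_const 1
    exact h3.add h2
  have h2 : Integrable (fun w : V => ‖1 + 2 * ‖w‖‖ ^ 6) μ := MemLp.integrable_norm_pow (p := 6) (by exact_mod_cast h1) (by norm_num)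
  refine h2.congr (.of_forall fun w => ?_)
  have : 0 ≤ 1 + 2 * ‖w‖ := by positivity
  simp [abs_of_nonneg this]

lemma poly_int (μ : Measure V) [IsGaussian μ] {g : V → ℝ} (hg : Continuous g) {C : ℝ}
    (h : ∀ w, |g w| ≤ C * (1 + 2 * ‖w‖) ^ 6) : Integrable g μ :=
  ((N6 μ).const_mul C).mono' hg.aestronglyMeasurable (.of_forall h)

lemma sq_int (μ : Measure V) [IsGaussian μ] : Integrable (fun w => ‖w‖ ^ 2) μ := by
  refine poly_int μ (by fun_prop) (C := 1) fun w => ?_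
  have h0 := norm_nonneg w
  rw [abs_of_nonneg (by positivity), one_mul]
  calc ‖w‖ ^ 2 ≤ (1 + 2 * ‖w‖) ^ 2 := by gcongr; linarith
    _ ≤ _ := pow_le_pow_right₀ (by linarith) (by norm_num)

lemma dual_mul_int (μ : Measure V) [IsGaussian μ] (l m : StrongDual ℝ V) :
    Integrable (fun w => l w * m w) μ := by
  refine ((sq_int μ).const_mul (‖l‖ * ‖m‖)).mono' (by fun_prop) (.of_forall fun w => ?_)
  rw [norm_mul]
  calc ‖l w‖ * ‖m w‖ ≤ (‖l‖ * ‖w‖) * (‖m‖ * ‖w‖) := by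
        gcongr <;> exact ContinuousLinearMap.le_opNorm _ _
    _ = _ := by ring

lemma dual_int (μ : Measure V) [IsGaussian μ] (l : StrongDual ℝ V) : Integrable (fun w => l w) μ :=
  l.integrable_comp (IsGaussian.integrable_id (μ := μ))

lemma dual_mean {μ : Measure V} [IsGaussian μ] (hμ : μ[id] = 0) (l : StrongDual ℝ V) :
    ∫ y, l y ∂μ = 0 := by
  have := l.integral_comp_comm (IsGaussian.integrable_id (μ := μ))
  rw [hμ] at this
  simpa using this

lemma Cl.dev {ε K : ℝ} {F : V → ℝ} (hF : Cl ε K F) (hε : 0 < ε) {μ : Measure V} [IsGaussian μ]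
    (hμ : μ[id] = 0) (r : ℝ) {x : V} {l : StrongDual ℝ V}
    (hl : ∀ u, |F (x + u) - F x - l u| ≤ K * ‖u‖ ^ 2) :
    |F x - Bor.Pr μ r F x| ≤ K * r ^ 2 * ∫ y, ‖y‖ ^ 2 ∂μ := by
  have hFc := hF.cont
  have hint : Integrable (fun y => F (x + r • y)) μ :=
    bdd_int μ (by fun_prop) (fun y => hF.abs_le hε _)
  have hint' : Integrable (fun y => F (x + r • y) - F x) μ := hint.sub (integrable_const _)
  have h2 : Integrable (fun y => l (r • y)) μ := by
    simpa using (dual_int μ l).const_mul r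
  have e : Bor.Pr μ r F x - F x = ∫ y, (F (x + r • y) - F x - l (r • y)) ∂μ := by
    rw [integral_sub hint' h2, integral_sub hint (integrable_const _)]
    simp [Bor.Pr, integral_const_mul, dual_mean hμ]
  rw [abs_sub_comm, e]
  rw [← integral_const_mul, ← Real.norm_eq_abs]
  refine norm_integral_le_of_norm_le ((sq_int μ).const_mul (K * r ^ 2))
    (.of_forall fun y => ?_)
  refine (hl _).trans_eq ?_
  rw [norm_smul, mul_pow, Real.norm_eq_abs, sq_abs]; ring

lemma Y_mp {μ : Measure V} [IsGaussian μ] (hμ : μ[id] = 0) {ρ σ : ℝ} (h : ρ ^ 2 + σ ^ 2 = 1) :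
    MeasurePreserving (fun w : V × V => ρ • w.1 + σ • w.2) (μ.prod μ) μ :=
  (measurePreserving_fst (μ := μ) (ν := μ)).comp (rot μ hμ ρ σ h)

lemma J_comp_cont {α : Type*} [TopologicalSpace α] {ρ σ ε : ℝ} (hσ : 0 < σ)
    (h : ρ ^ 2 + σ ^ 2 = 1) (hε : 0 < ε) {f g : α → ℝ} (hf : Continuous f) (hg : Continuous g)
    (hf' : ∀ x, f x ∈ Icc ε (1 - ε)) (hg' : ∀ x, g x ∈ Icc ε (1 - ε)) :
    Continuous (fun x => J ρ σ (f x) (g x)) := by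
  refine (J_continuousOn hσ h).comp_continuous (f := fun x => (f x, g x)) (by fun_prop) fun x => ?_
  have a := hf' x
  have b := hg' x
  exact ⟨⟨by linarith [a.1], by linarith [a.2]⟩, ⟨by linarith [b.1], by linarith [b.2]⟩⟩

lemma step1 {μ : Measure V} [IsGaussian μ] (hμ : μ[id] = 0) {ρ σ ε K : ℝ} (hρ : 0 ≤ ρ)
    (hσ : 0 < σ) (h : ρ ^ 2 + σ ^ 2 = 1) (hε : 0 < ε) (hK : 0 ≤ K) :
    ∃ C', 0 ≤ C' ∧ ∀ r, 0 ≤ r → r ≤ 1 → ∀ F : V → ℝ, Cl ε K F → ∀ x y,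
      ∫ w, J ρ σ (F (x + r • w.1)) (F (y + r • (ρ • w.1 + σ • w.2))) ∂(μ.prod μ) ≤
        J ρ σ (Pr μ r F x) (Pr μ r F y) + C' * r ^ 3 := by
  obtain ⟨C, hC, hT⟩ := J_taylor hρ hσ h hε
  set M := ∫ y, ‖y‖ ^ 2 ∂μ with hM
  have hM0 : 0 ≤ M := integral_nonneg fun y => by positivity
  set K1 := K * (1 + M) with hK1
  have hK10 : 0 ≤ K1 := by positivity
  have hKK : K ≤ K1 := by nlinarith
  set C1 := C * (12 * K1 ^ 2 + 64 * K1 ^ 3) with hC1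
  have hC10 : 0 ≤ C1 := by positivity
  set N : V × V → ℝ := fun w => 1 + 2 * ‖w‖ with hN
  refine ⟨C1 * ∫ w, N w ^ 6 ∂(μ.prod μ), ?_, ?_⟩
  · refine mul_nonneg hC10 (integral_nonneg fun w => ?_)
    simp only [hN, Pi.zero_apply]; positivity
  intro r hr hr1 F hF x y
  obtain ⟨L, -, hLK, hL⟩ := hF.ex
  have hFc := hF.cont
  set l := L x
  set m := L y
  set Y : V × V → V := fun w => ρ • w.1 + σ • w.2 with hY
  have hYc : Continuous Y := by fun_prop
  have hYmp : MeasurePreserving Y (μ.prod μ) μ := Y_mp hμ h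
  have hXmp : MeasurePreserving (Prod.fst : V × V → V) (μ.prod μ) μ := measurePreserving_fst
  set a := Pr μ r F x with ha
  set c := Pr μ r F y with hc
  have hP := hF.Pr hε μ r
  obtain ⟨A, B, D, E, H, hD, hE, hH, hneg, hJ⟩ := hT a (hP.mem x) c (hP.mem y)
  have hρ1 : ρ ≤ 1 := by nlinarith
  have hσ1 : σ ≤ 1 := by nlinarith
  have hYn : ∀ w, ‖Y w‖ ≤ N w := fun w => by
    have h1 := norm_fst_le w
    have h2 := norm_snd_le w
    calc ‖Y w‖ ≤ ρ * ‖w.1‖ + σ * ‖w.2‖ := by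
          refine (norm_add_le _ _).trans_eq ?_
          rw [norm_smul, norm_smul, Real.norm_of_nonneg hρ, Real.norm_of_nonneg hσ.le]
      _ ≤ 1 * ‖w‖ + 1 * ‖w‖ := by gcongr
      _ ≤ N w := by simp only [hN]; linarith
  have hXn : ∀ w : V × V, ‖w.1‖ ≤ N w := fun w => by
    have h1 := norm_fst_le w
    have := norm_nonneg w
    simp only [hN]; linarith
  have hN1 : ∀ w, 1 ≤ N w := fun w => by
    have := norm_nonneg w
    simp only [hN]; linarith
  have lin : ∀ z u : V, ∀ n : ℝ, ‖u‖ ≤ n → |r * L z u| ≤ K1 * r * n := fun z u n hn => by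
    rw [abs_mul, abs_of_nonneg hr]
    have : |L z u| ≤ K1 * n := by
      refine ((L z).le_opNorm u).trans ?_
      have := (hLK z).trans hKK
      gcongr
    calc r * |L z u| ≤ r * (K1 * n) := by gcongr
      _ = _ := by ring
  have rem : ∀ z u : V, ∀ n : ℝ, 1 ≤ n → ‖u‖ ≤ n →
      |F (z + r • u) - Pr μ r F z - r * L z u| ≤ K1 * r ^ 2 * n ^ 2 := fun z u n hn1 hn => by
    have e1 := hF.dev hε hμ r (hL z)
    have e2 := hL z (r • u)
    have e3 : F (z + r • u) - Pr μ r F z - r * L z u =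
      (F (z + r • u) - F z - L z (r • u)) + (F z - Pr μ r F z) := by
      simp; ring
    rw [e3]
    refine (abs_add_le _ _).trans ((add_le_add e2 e1).trans ?_)
    rw [norm_smul, Real.norm_of_nonneg hr, ← hM]
    have i1 : ‖u‖ ^ 2 ≤ n ^ 2 := by gcongr
    have i2 : M ≤ M * n ^ 2 := le_mul_of_one_le_right hM0 (one_le_pow₀ hn1)
    calc K * (r * ‖u‖) ^ 2 + K * r ^ 2 * M = K * r ^ 2 * (‖u‖ ^ 2 + M) := by ring
      _ ≤ K * r ^ 2 * (n ^ 2 + M * n ^ 2) := by gcongr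
      _ = _ := by rw [hK1]; ring
  have hpt : ∀ w : V × V, J ρ σ (F (x + r • w.1)) (F (y + r • Y w)) ≤
      (J ρ σ a c + (A * (F (x + r • w.1) - a) + B * (F (y + r • Y w) - c))) +
      (r ^ 2 * (D * (l w.1 * l w.1) + 2 * E * (l w.1 * m (Y w)) + H * (m (Y w) * m (Y w))) +
        C1 * r ^ 3 * N w ^ 6) := fun w => by
    have h1 := hJ _ (hF.mem (x + r • w.1)) _ (hF.mem (y + r • Y w))
    have h2 := arith_step (u := F (x + r • w.1) - a) (v := F (y + r • Y w) - c)
      (p := r * l w.1) (q := r * m (Y w)) (R1 := F (x + r • w.1) - a - r * l w.1)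
      (R2 := F (y + r • Y w) - c - r * m (Y w)) hC hK10 hr hr1 (hN1 w) hD hE hH (by ring) (by ring)
      (lin _ _ _ (hXn w)) (lin _ _ _ (hYn w)) (rem _ _ _ (hN1 w) (hXn w)) (rem _ _ _ (hN1 w) (hYn w))
    rw [← hC1] at h2
    linarith
  -- integrals
  have iF : ∀ z, ∀ T : V × V → V, Continuous T → Integrable (fun w => F (z + r • T w)) (μ.prod μ) :=
    fun z T hT => bdd_int _ (by fun_prop) (fun y => hF.abs_le hε _)
  have iu : Integrable (fun w : V × V => F (x + r • w.1) - a) (μ.prod μ) :=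
    (iF x Prod.fst continuous_fst).sub (integrable_const _)
  have iv : Integrable (fun w : V × V => F (y + r • Y w) - c) (μ.prod μ) :=
    (iF y Y hYc).sub (integrable_const _)
  have u0 : ∫ w : V × V, (F (x + r • w.1) - a) ∂(μ.prod μ) = 0 := by
    rw [integral_sub (iF x Prod.fst continuous_fst) (integrable_const _),
      mp_int hXmp (g := fun z => F (x + r • z)) (by fun_prop)]
    simp [ha, Bor.Pr]
  have v0 : ∫ w : V × V, (F (y + r • Y w) - c) ∂(μ.prod μ) = 0 := by
    rw [integral_sub (iF y Y hYc) (integrable_const _),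
      mp_int hYmp (g := fun z => F (y + r • z)) (by fun_prop)]
    simp [hc, Bor.Pr]
  have q1 : ∫ w : V × V, l w.1 * l w.1 ∂(μ.prod μ) = ∫ z, l z * l z ∂μ :=
    mp_int hXmp (g := fun z => l z * l z) (by fun_prop)
  have q3 : ∫ w : V × V, m (Y w) * m (Y w) ∂(μ.prod μ) = ∫ z, m z * m z ∂μ :=
    mp_int hYmp (g := fun z => m z * m z) (by fun_prop)
  let l' : StrongDual ℝ (V × V) := l.comp (ContinuousLinearMap.fst ℝ V V)
  let m' : StrongDual ℝ (V × V) := m.comp (ρ • ContinuousLinearMap.fst ℝ V V + σ • ContinuousLinearMap.snd ℝ V V)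
  have j1 : Integrable (fun w : V × V => l w.1 * l w.1) (μ.prod μ) := dual_mul_int _ l' l'
  have j2 : Integrable (fun w : V × V => l w.1 * m (Y w)) (μ.prod μ) := dual_mul_int _ l' m'
  have j3 : Integrable (fun w : V × V => m (Y w) * m (Y w)) (μ.prod μ) := dual_mul_int _ m' m'
  have q2 : ∫ w : V × V, l w.1 * m (Y w) ∂(μ.prod μ) = ρ * ∫ z, l z * m z ∂μ := by
    have e : ∀ w : V × V, l w.1 * m (Y w) = ρ * (l w.1 * m w.1) + σ * (l w.1 * m w.2) := fun w => by
      simp [hY]; ring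
    have k1 : Integrable (fun w : V × V => l w.1 * m w.1) (μ.prod μ) :=
      dual_mul_int _ l' (m.comp (ContinuousLinearMap.fst ℝ V V))
    have k2 : Integrable (fun w : V × V => l w.1 * m w.2) (μ.prod μ) :=
      dual_mul_int _ l' (m.comp (ContinuousLinearMap.snd ℝ V V))
    simp_rw [e]
    rw [integral_add (k1.const_mul _) (k2.const_mul _), integral_const_mul, integral_const_mul,
      integral_prod_mul (fun z => l z) (fun z => m z), dual_mean hμ, zero_mul, mul_zero, add_zero,
      mp_int hXmp (g := fun z => l z * m z) (by fun_prop)]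
  have hquad : D * (∫ z, l z * l z ∂μ) + 2 * E * (ρ * ∫ z, l z * m z ∂μ) + H * (∫ z, m z * m z ∂μ) ≤ 0 := by
    have e : D * (∫ z, l z * l z ∂μ) + 2 * E * (ρ * ∫ z, l z * m z ∂μ) + H * (∫ z, m z * m z ∂μ) =
        ∫ z, (D * (l z * l z) + (2 * E * ρ) * (l z * m z) + H * (m z * m z)) ∂μ := by
      have k1 := (dual_mul_int μ l l).const_mul D
      have k2 := (dual_mul_int μ l m).const_mul (2 * E * ρ)
      have k3 := (dual_mul_int μ m m).const_mul H
      have k12 : Integrable (fun z => D * (l z * l z) + (2 * E * ρ) * (l z * m z)) μ := k1.add k2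
      rw [integral_add k12 k3, integral_add k1 k2, integral_const_mul, integral_const_mul,
        integral_const_mul]; ring
    rw [e]
    refine integral_nonpos fun z => ?_
    have := hneg (l z) (m z)
    simp only [Pi.zero_apply]; linarith
  have I1 : Integrable (fun w : V × V => A * (F (x + r • w.1) - a) + B * (F (y + r • Y w) - c)) (μ.prod μ) :=
    (iu.const_mul A).add (iv.const_mul B)
  have I1' : Integrable (fun w : V × V => J ρ σ a c + (A * (F (x + r • w.1) - a) + B * (F (y + r • Y w) - c))) (μ.prod μ) :=
    (integrable_const _).add I1
  have I20 : Integrable (fun w : V × V => D * (l w.1 * l w.1) + 2 * E * (l w.1 * m (Y w))) (μ.prod μ) :=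
    (j1.const_mul D).add (j2.const_mul (2 * E))
  have I21 : Integrable (fun w : V × V => D * (l w.1 * l w.1) + 2 * E * (l w.1 * m (Y w)) + H * (m (Y w) * m (Y w))) (μ.prod μ) :=
    I20.add (j3.const_mul H)
  have I3 : Integrable (fun w => C1 * r ^ 3 * N w ^ 6) (μ.prod μ) := (N6 (μ.prod μ)).const_mul _
  have I2 : Integrable (fun w : V × V => r ^ 2 * (D * (l w.1 * l w.1) + 2 * E * (l w.1 * m (Y w)) + H * (m (Y w) * m (Y w))) +
        C1 * r ^ 3 * N w ^ 6) (μ.prod μ) := (I21.const_mul _).add I3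
  have I0 : Integrable (fun w : V × V => J ρ σ (F (x + r • w.1)) (F (y + r • Y w))) (μ.prod μ) := by
    refine bdd_int _ (C := 1) (J_comp_cont hσ h hε (by fun_prop) (by fun_prop)
      (fun w => hF.mem _) (fun w => hF.mem _)) fun w => ?_
    rw [Real.norm_of_nonneg (J_nonneg _ _ _ _)]
    exact J_le_one _ _ _ _
  refine (integral_mono I0 (I1'.add I2) hpt).trans ?_
  have hfin := integral_add I1' I2
  simp only [Pi.add_apply]
  rw [hfin, integral_add (integrable_const _) I1, integral_add (iu.const_mul A) (iv.const_mul B),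
    integral_const_mul, integral_const_mul, u0, v0, integral_add (I21.const_mul _) I3,
    integral_const_mul, integral_const_mul, integral_add I20 (j3.const_mul H),
    integral_add (j1.const_mul D) (j2.const_mul (2 * E)), integral_const_mul, integral_const_mul,
    integral_const_mul, q1, q2, q3]
  have : r ^ 2 * (D * (∫ z, l z * l z ∂μ) + 2 * E * (ρ * ∫ z, l z * m z ∂μ) + H * (∫ z, m z * m z ∂μ)) ≤ 0 :=
    mul_nonpos_of_nonneg_of_nonpos (by positivity) hquad
  simp only [integral_const, probReal_univ, smul_eq_mul]
  linarith

end
end Bor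

namespace Bor
open Set

section
variable {V : Type*} [NormedAddCommGroup V] [NormedSpace ℝ V] [MeasurableSpace V]
    [BorelSpace V] [SecondCountableTopology V] [CompleteSpace V]

lemma prod_mean {μ : Measure V} [IsGaussian μ] (hμ : μ[id] = 0) : (μ.prod μ)[id] = 0 := by
  have hi : Integrable (id : V × V → V × V) (μ.prod μ) := IsGaussian.integrable_id
  have hi1 : Integrable (id : V → V) μ := IsGaussian.integrable_id
  have hi1' : AEStronglyMeasurable (id : V → V) μ := hi1.aestronglyMeasurable
  refine Prod.ext ?_ ?_
  · rw [fst_integral hi]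
    have : ∫ w : V × V, (id w).1 ∂(μ.prod μ) = ∫ y, id y ∂(Measure.map Prod.fst (μ.prod μ)) := by
      rw [integral_map (by fun_prop) (by rw [(measurePreserving_fst (μ := μ) (ν := μ)).map_eq]; exact hi1')]
      rfl
    rw [this, (measurePreserving_fst (μ := μ) (ν := μ)).map_eq, hμ]; rfl
  · rw [snd_integral hi]
    have : ∫ w : V × V, (id w).2 ∂(μ.prod μ) = ∫ y, id y ∂(Measure.map Prod.snd (μ.prod μ)) := by
      rw [integral_map (by fun_prop) (by rw [(measurePreserving_snd (μ := μ) (ν := μ)).map_eq]; exact hi1')]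
      rfl
    rw [this, (measurePreserving_snd (μ := μ) (ν := μ)).map_eq, hμ]; rfl

def Er (μ : Measure V) (ρ σ ε K δ r : ℝ) : Prop := ∀ F : V → ℝ, Cl ε K F → ∀ x y,
      ∫ w, J ρ σ (F (x + r • w.1)) (F (y + r • (ρ • w.1 + σ • w.2))) ∂(μ.prod μ) ≤
        J ρ σ (Pr μ r F x) (Pr μ r F y) + δ

lemma hsq : (1 / √2 : ℝ) ^ 2 + (1 / √2) ^ 2 = 1 := by
  rw [div_pow, Real.sq_sqrt (by norm_num)]; norm_num

lemma hs2 (r : ℝ) : √2 * r * (1 / √2) = r := by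
  have : √2 ≠ 0 := by positivity
  field_simp

lemma Pr_Pr {μ : Measure V} [IsGaussian μ] (hμ : μ[id] = 0) {ε K : ℝ} (hε : 0 < ε) {F : V → ℝ}
    (hF : Cl ε K F) (r : ℝ) (x : V) : Pr μ r (Pr μ r F) x = Pr μ (√2 * r) F x := by
  have hFc := hF.cont
  have hmp := Y_mp hμ hsq
  unfold Pr
  rw [← mp_int hmp (g := fun y => F (x + (√2 * r) • y)) (by fun_prop)]
  simp_rw [smul_add, smul_smul, hs2]
  rw [integral_prod]
  · simp_rw [add_assoc]
  · exact bdd_int _ (by fun_prop) (fun y => hF.abs_le hε _)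

lemma Er_double {μ : Measure V} [IsGaussian μ] (hμ : μ[id] = 0) {ρ σ ε K δ r : ℝ}
    (hσ : 0 < σ) (h : ρ ^ 2 + σ ^ 2 = 1) (hε : 0 < ε) (hE : Er μ ρ σ ε K δ r) :
    Er μ ρ σ ε K (2 * δ) (√2 * r) := by
  intro F hF x y
  have hFc := hF.cont
  have hP := hF.Pr hε μ r
  have hPc := hP.cont
  have cont : ∀ {W : Type _} [TopologicalSpace W] {G : V → ℝ}, Cl ε K G → ∀ {f g : W → V}, Continuous f →
      Continuous g → Continuous fun w => J ρ σ (G (f w)) (G (g w)) := fun {W} _ {G} hG {f g} hf hg =>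
    J_comp_cont hσ h hε (hG.cont.comp hf) (hG.cont.comp hg) (fun w => hG.mem _) (fun w => hG.mem _)
  have bd : ∀ a b, ‖J ρ σ a b‖ ≤ 1 := fun a b => by
    rw [Real.norm_of_nonneg (J_nonneg _ _ _ _)]; exact J_le_one _ _ _ _
  have hmp := Y_mp (prod_mean hμ) hsq
  rw [← mp_int hmp (g := fun w : V × V => J ρ σ (F (x + (√2 * r) • w.1)) (F (y + (√2 * r) • (ρ • w.1 + σ • w.2))))
    (cont hF (by fun_prop) (by fun_prop))]
  have e : ∀ p : (V × V) × (V × V), J ρ σ (F (x + (√2 * r) • ((1 / √2 : ℝ) • p.1 + (1 / √2 : ℝ) • p.2).1))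
      (F (y + (√2 * r) • (ρ • ((1 / √2 : ℝ) • p.1 + (1 / √2 : ℝ) • p.2).1 +
        σ • ((1 / √2 : ℝ) • p.1 + (1 / √2 : ℝ) • p.2).2))) =
      J ρ σ (F ((x + r • p.1.1) + r • p.2.1)) (F ((y + r • (ρ • p.1.1 + σ • p.1.2)) +
        r • (ρ • p.2.1 + σ • p.2.2))) := fun p => by
    congr 2
    · simp only [Prod.fst_add, Prod.smul_fst, smul_add, smul_smul, hs2, add_assoc]
    · have e1 : ∀ t : ℝ, √2 * r * (t * (1 / √2)) = r * t := fun t => by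
        have := hs2 r
        linear_combination t * this
      simp only [Prod.fst_add, Prod.snd_add, Prod.smul_fst, Prod.smul_snd, smul_add, smul_smul, e1]
      abel
  simp_rw [e]
  have hint : Integrable (fun p : (V × V) × (V × V) => J ρ σ (F ((x + r • p.1.1) + r • p.2.1)) (F ((y + r • (ρ • p.1.1 + σ • p.1.2)) +
        r • (ρ • p.2.1 + σ • p.2.2)))) ((μ.prod μ).prod (μ.prod μ)) :=
    bdd_int _ (cont hF (by fun_prop) (by fun_prop)) (fun w => bd _ _)
  rw [integral_prod _ hint]
  have h2 : Integrable (fun p : V × V => J ρ σ (Pr μ r F (x + r • p.1)) (Pr μ r F (y + r • (ρ • p.1 + σ • p.2)))) (μ.prod μ) :=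
    bdd_int _ (cont hP (by fun_prop) (by fun_prop)) (fun w => bd _ _)
  have h3 := integral_mono hint.integral_prod_left (h2.add (integrable_const δ))
    (fun p => hE F hF (x + r • p.1) (y + r • (ρ • p.1 + σ • p.2)))
  refine h3.trans ?_
  have h4 := integral_add h2 (integrable_const δ)
  simp only [Pi.add_apply]
  rw [h4]
  have h5 := hE _ hP x y
  rw [Pr_Pr hμ hε hF, Pr_Pr hμ hε hF] at h5
  simp only [integral_const, probReal_univ, smul_eq_mul]
  linarith

lemma smooth_ineq {μ : Measure V} [IsGaussian μ] (hμ : μ[id] = 0) {ρ σ ε K : ℝ} (hρ : 0 ≤ ρ)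
    (hσ : 0 < σ) (h : ρ ^ 2 + σ ^ 2 = 1) (hε : 0 < ε) {F : V → ℝ} (hF : Cl ε K F) :
    ∫ w, J ρ σ (F w.1) (F (ρ • w.1 + σ • w.2)) ∂(μ.prod μ) ≤ J ρ σ (∫ y, F y ∂μ) (∫ y, F y ∂μ) := by
  have hK : 0 ≤ K := by
    obtain ⟨L, -, hL, -⟩ := hF.ex
    exact (norm_nonneg _).trans (hL 0)
  obtain ⟨C, hC, h1⟩ := step1 hμ hρ hσ h hε hK
  have h2 : ∀ k : ℕ, ∀ r, 0 ≤ r → r ≤ 1 → Er μ ρ σ ε K (2 ^ k * (C * r ^ 3)) (√2 ^ k * r) := by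
    intro k
    induction k with
    | zero => intro r hr hr1 F hF x y; simpa using h1 r hr hr1 F hF x y
    | succ k ih =>
      intro r hr hr1
      have := Er_double hμ hσ h hε (ih r hr hr1)
      convert this using 1 <;> ring
  have hs0 : 0 < √2 := by positivity
  have hs1 : 1 < √2 := by
    rw [Real.lt_sqrt] <;> norm_num
  have h3 : ∀ k : ℕ, ∫ w, J ρ σ (F w.1) (F (ρ • w.1 + σ • w.2)) ∂(μ.prod μ) ≤
      J ρ σ (∫ y, F y ∂μ) (∫ y, F y ∂μ) + C * (1 / √2) ^ k := by
    intro k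
    have := h2 k ((1 / √2) ^ k) (by positivity) (pow_le_one₀ (by positivity) (by
      rw [div_le_one hs0]; exact hs1.le)) F hF 0 0
    have e1 : √2 ^ k * (1 / √2) ^ k = 1 := by
      rw [← mul_pow, mul_one_div_cancel hs0.ne', one_pow]
    have e2 : 2 ^ k * (C * ((1 / √2) ^ k) ^ 3) = C * (1 / √2) ^ k := by
      have e3 : (2 : ℝ) ^ k * ((1 / √2) ^ k) ^ 2 = 1 := by
        rw [← pow_mul, mul_comm k 2, pow_mul, ← mul_pow, div_pow, Real.sq_sqrt (by norm_num)]
        norm_num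
      linear_combination C * (1 / √2) ^ k * e3
    rw [e1, e2] at this
    simpa [Bor.Pr] using this
  have lim : Filter.Tendsto (fun k : ℕ => J ρ σ (∫ y, F y ∂μ) (∫ y, F y ∂μ) + C * (1 / √2) ^ k) Filter.atTop
      (nhds (J ρ σ (∫ y, F y ∂μ) (∫ y, F y ∂μ) + C * 0)) := by
    refine tendsto_const_nhds.add (tendsto_const_nhds.mul ?_)
    exact tendsto_pow_atTop_nhds_zero_of_lt_one (by positivity) (by rw [div_lt_one hs0]; exact hs1)
  have := ge_of_tendsto' lim h3
  simpa using this

end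
end Bor

namespace Bor
open Set

lemma mp_int' {α β : Type*} [MeasurableSpace α] [MeasurableSpace β]
    {ν : Measure α} {μ : Measure β} {f : α → β}
    (h : MeasurePreserving f ν μ) {g : β → ℝ} (hg : AEStronglyMeasurable g μ) :
    ∫ w, g (f w) ∂ν = ∫ y, g y ∂μ := by
  rw [← h.map_eq, integral_map h.measurable.aemeasurable (by rwa [h.map_eq])]

noncomputable def chi (ε t : ℝ) : ℝ := 1 / 2 - (1 - 2 * ε) / 2 * Real.cos (Real.pi * t)

lemma chi_mem {ε : ℝ} (hε : ε ≤ 1 / 2) (t : ℝ) : chi ε t ∈ Icc ε (1 - ε) := by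
  have h1 := Real.neg_one_le_cos (Real.pi * t)
  have h2 := Real.cos_le_one (Real.pi * t)
  constructor <;> unfold chi <;> nlinarith

lemma chi_zero (ε : ℝ) : chi ε 0 = ε := by simp [chi]; ring
lemma chi_one (ε : ℝ) : chi ε 1 = 1 - ε := by simp [chi]; ring

lemma chi_lip {ε : ℝ} (h0 : 0 ≤ ε) (hε : ε ≤ 1 / 2) (s t : ℝ) : |chi ε s - chi ε t| ≤ 2 * |s - t| := by
  have e : chi ε s - chi ε t = ((1 - 2 * ε) / 2) * (Real.cos (Real.pi * t) - Real.cos (Real.pi * s)) := by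
    unfold chi; ring
  rw [e, abs_mul, abs_of_nonneg (by linarith)]
  have h1 := Real.abs_cos_sub_cos_le (Real.pi * t) (Real.pi * s)
  rw [← mul_sub, abs_mul, abs_of_pos Real.pi_pos, abs_sub_comm t s] at h1
  have h2 : Real.pi * |s - t| ≤ 4 * |s - t| := by gcongr; exact Real.pi_le_four
  calc _ ≤ (1 / 2) * (4 * |s - t|) := by
        gcongr
        · linarith
        · linarith
    _ = _ := by ring

section
variable {V : Type*} [NormedAddCommGroup V] [NormedSpace ℝ V] [MeasurableSpace V]
    [BorelSpace V] [SecondCountableTopology V] [CompleteSpace V]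

open scoped ContDiff in
lemma Cl_of {ε : ℝ} (hε : ε ≤ 1 / 2) {g : V → ℝ} (hg : HasCompactSupport g) (hs : ContDiff ℝ ∞ g) :
    ∃ K, Cl ε K (fun x => chi ε (g x)) := by
  have hchi : ContDiff ℝ ∞ (chi ε) := by unfold chi; fun_prop
  let f : V → ℝ := fun x => chi ε (g x) - ε
  have hf : ContDiff ℝ ∞ f := (hchi.comp hs).sub contDiff_const
  have hfs : HasCompactSupport f := hg.comp_left (g := fun t => chi ε t - ε) (by simp [chi_zero])
  have hds : HasCompactSupport (fderiv ℝ f) := hfs.fderiv ℝ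
  have hd : ContDiff ℝ ∞ (fderiv ℝ f) := hf.fderiv_right (by simp)
  obtain ⟨C1, h1⟩ := hds.exists_bound_of_continuous hd.continuous
  obtain ⟨C2, h2⟩ := hd.lipschitzWith_of_hasCompactSupport hds (by simp)
  refine ⟨max C1 C2, fun x => chi_mem hε _, hchi.continuous.comp hs.continuous, fderiv ℝ f,
    hd.continuous, fun x => (h1 x).trans (le_max_left _ _), fun x u => ?_⟩
  have := (convex_closedBall x ‖u‖).norm_image_sub_le_of_norm_fderiv_le' (f := f) (φ := fderiv ℝ f x)
    (C := C2 * ‖u‖) (𝕜 := ℝ) (x := x) (y := x + u)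
    (fun z _ => (hf.differentiable (by simp)).differentiableAt) (fun z hz => by
      refine (h2.norm_sub_le z x).trans ?_
      have : ‖z - x‖ ≤ ‖u‖ := by simpa [dist_eq_norm] using hz
      gcongr) (by simp) (by simp)
  have e : f (x + u) - f x = chi ε (g (x + u)) - chi ε (g x) := by simp [f]
  rw [e, add_sub_cancel_left, Real.norm_eq_abs] at this
  refine this.trans ?_
  rw [mul_assoc, ← sq]
  gcongr
  exact le_max_right _ _

variable [FiniteDimensional ℝ V]

lemma set_approx {μ : Measure V} [IsGaussian μ] (hμ : μ[id] = 0) {ρ σ ε δ : ℝ} (hρ : 0 ≤ ρ)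
    (hσ : 0 < σ) (h : ρ ^ 2 + σ ^ 2 = 1) (hε : 0 < ε) (hε2 : ε < 1 / 2) (hδ : 0 < δ)
    {A : Set V} (hA : MeasurableSet A) (hA2 : μ.real A = 1 / 2) :
    (1 - 2 * ε) * (μ.prod μ).real {w | w.1 ∈ A ∧ ρ • w.1 + σ • w.2 ∈ A} ≤ KK ρ σ 0 0 + 8 * δ := by
  set f : V → ℝ := A.indicator 1 with hf
  have hfi : Integrable f μ := (integrable_const (1:ℝ)).indicator hA
  obtain ⟨g, hgs, hgc, hg⟩ := (memLp_one_iff_integrable.2 hfi).exist_eLpNorm_sub_le (by simp) le_rfl hδ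
  have hgi : Integrable g μ := hgc.continuous.integrable_of_hasCompactSupport hgs
  have hD : ∫ y, |f y - g y| ∂μ ≤ δ := by
    rw [eLpNorm_one_eq_lintegral_enorm] at hg
    have := integral_norm_eq_lintegral_enorm (hfi.sub hgi).aestronglyMeasurable
    simp only [Pi.sub_apply, Real.norm_eq_abs] at this hg
    rw [this]
    exact ENNReal.toReal_le_of_le_ofReal hδ.le hg
  obtain ⟨K, hF⟩ := Cl_of hε2.le hgs hgc
  set F : V → ℝ := fun x => chi ε (g x) with hFd
  have hFc := hF.cont
  set G : V → ℝ := fun x => chi ε (f x) with hGd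
  have hG : G = fun x => ε + (1 - 2 * ε) * f x := by
    funext x
    by_cases hx : x ∈ A
    · simp [hGd, hf, hx, chi_one]; ring
    · simp [hGd, hf, hx, chi_zero]
  have hGi : Integrable G μ := by
    rw [hG]; exact (integrable_const _).add (hfi.const_mul _)
  have hFi : Integrable F μ := bdd_int μ hFc (fun y => hF.abs_le hε _)
  have hG2 : ∫ y, G y ∂μ = 1 / 2 := by
    rw [hG, integral_add (integrable_const _) (hfi.const_mul _), integral_const_mul, hf,
      integral_indicator_one hA, hA2]
    simp; ring
  set d : V → ℝ := fun y => |F y - G y| with hd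
  have hdi : Integrable d μ := (hFi.sub hGi).abs
  have hd2 : ∫ y, d y ∂μ ≤ 2 * δ := by
    have := integral_mono hdi ((hfi.sub hgi).abs.const_mul 2) (fun y => by
      have := chi_lip hε.le hε2.le (g y) (f y)
      rw [abs_sub_comm (g y)] at this
      exact this)
    rw [integral_const_mul] at this
    simp only [Pi.sub_apply] at this
    linarith
  set Y : V × V → V := fun w => ρ • w.1 + σ • w.2 with hY
  have hYc : Continuous Y := by fun_prop
  have hYmp : MeasurePreserving Y (μ.prod μ) μ := Y_mp hμ h
  have hXmp : MeasurePreserving (Prod.fst : V × V → V) (μ.prod μ) μ := measurePreserving_fst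
  have hsub : ∀ {z}, z ∈ Icc ε (1 - ε) → z ∈ Ioo (0:ℝ) 1 := fun hz =>
    ⟨by linarith [hz.1], by linarith [hz.2]⟩
  set S : Set (V × V) := {w | w.1 ∈ A ∧ Y w ∈ A} with hS
  have hSm : MeasurableSet S := (measurable_fst hA).inter (hYc.measurable hA)
  have hpt : ∀ w : V × V, (1 - 2 * ε) * S.indicator 1 w ≤ J ρ σ (F w.1) (F (Y w)) + (d w.1 + d (Y w)) := by
    intro w
    have m1 := hsub (hF.mem w.1)
    have m2 := hsub (hF.mem (Y w))
    have m3 : G w.1 ∈ Ioo (0:ℝ) 1 := hsub (chi_mem hε2.le _)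
    have m4 : G (Y w) ∈ Ioo (0:ℝ) 1 := hsub (chi_mem hε2.le _)
    have l := (abs_le.1 (J_lip hσ h m1 m2 m3 m4)).1
    have : (1 - 2 * ε) * S.indicator 1 w ≤ J ρ σ (G w.1) (G (Y w)) := by
      by_cases hw : w ∈ S
      · have := J_ge h m3 m4
        have e1 : G w.1 = 1 - ε := by simp [hGd, hf, hw.1, chi_one]
        have e2 : G (Y w) = 1 - ε := by simp [hGd, hf, hw.2, chi_one]
        rw [e1, e2] at this ⊢
        simp only [hw, indicator_of_mem, Pi.one_apply]
        linarith
      · simp only [hw, not_false_eq_true, indicator_of_notMem, mul_zero]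
        exact J_nonneg _ _ _ _
    simp only [hd]
    linarith
  have i1 : Integrable (fun w => (1 - 2 * ε) * S.indicator 1 w) (μ.prod μ) :=
    ((integrable_const (1:ℝ)).indicator hSm).const_mul _
  have i2 : Integrable (fun w : V × V => J ρ σ (F w.1) (F (Y w))) (μ.prod μ) := by
    refine bdd_int _ (C := 1) (J_comp_cont hσ h hε (by fun_prop) (by fun_prop)
      (fun w => hF.mem _) (fun w => hF.mem _)) fun w => ?_
    rw [Real.norm_of_nonneg (J_nonneg _ _ _ _)]
    exact J_le_one _ _ _ _
  have i3 : Integrable (fun w : V × V => d w.1) (μ.prod μ) := hXmp.integrable_comp_of_integrable hdi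
  have i4 : Integrable (fun w : V × V => d (Y w)) (μ.prod μ) := hYmp.integrable_comp_of_integrable hdi
  have i34 : Integrable (fun w : V × V => d w.1 + d (Y w)) (μ.prod μ) := i3.add i4
  have key := integral_mono i1 (i2.add i34) hpt
  have e := integral_add i2 i34
  simp only [Pi.add_apply] at key
  rw [e, integral_add i3 i4, mp_int' hXmp hdi.aestronglyMeasurable, mp_int' hYmp hdi.aestronglyMeasurable,
    integral_const_mul, integral_indicator_one hSm] at key
  have key2 := smooth_ineq hμ hρ hσ h hε hF
  have hm : ∫ y, F y ∂μ ∈ Ioo (0:ℝ) 1 := by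
    have := (hF.Pr hε μ 1).mem 0
    simp only [Bor.Pr, zero_add, one_smul] at this
    exact hsub this
  have hh : (1 / 2 : ℝ) ∈ Ioo (0:ℝ) 1 := by norm_num
  have l := (abs_le.1 (J_lip hσ h hm hm hh hh)).2
  rw [J_half] at l
  have hdev : |∫ y, F y ∂μ - 1 / 2| ≤ 2 * δ := by
    rw [← hG2, ← integral_sub hFi hGi]
    exact (abs_integral_le_integral_abs).trans hd2
  linarith

lemma set_ineq {μ : Measure V} [IsGaussian μ] (hμ : μ[id] = 0) {ρ σ : ℝ} (hρ : 0 ≤ ρ)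
    (hσ : 0 < σ) (h : ρ ^ 2 + σ ^ 2 = 1)
    {A : Set V} (hA : MeasurableSet A) (hA2 : μ.real A = 1 / 2) :
    (μ.prod μ).real {w | w.1 ∈ A ∧ ρ • w.1 + σ • w.2 ∈ A} ≤ KK ρ σ 0 0 := by
  refine le_of_forall_pos_le_add fun t ht => ?_
  set P := (μ.prod μ).real {w | w.1 ∈ A ∧ ρ • w.1 + σ • w.2 ∈ A}
  have hP1 : P ≤ 1 := measureReal_le_one
  have hε : 0 < min (1 / 4) (t / 4) := by positivity
  have := set_approx hμ hρ hσ h hε (by linarith [min_le_left (1 / 4) (t / 4)])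
    (show 0 < t / 16 by positivity) hA hA2
  have h2 := min_le_right (1 / 4) (t / 4)
  have hP0 : 0 ≤ P := measureReal_nonneg
  nlinarith

end

instance isG (n : ℕ) : IsGaussian (Measure.pi fun _ : Fin n => gaussianReal 0 1) := by
  have h := map_pi_eq_stdGaussian (ι := Fin n)
  rw [← isGaussian_map_equiv_iff (PiLp.continuousLinearEquiv 2 ℝ (fun _ : Fin n => ℝ)).symm]
  have : ⇑(PiLp.continuousLinearEquiv 2 ℝ (fun _ : Fin n => ℝ)).symm = WithLp.toLp 2 := rfl
  rw [this, h]
  infer_instance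

lemma meanG (n : ℕ) : (Measure.pi fun _ : Fin n => gaussianReal 0 1)[id] = 0 := by
  funext i
  have hi : Integrable (id : (Fin n → ℝ) → (Fin n → ℝ)) (Measure.pi fun _ : Fin n => gaussianReal 0 1) :=
    IsGaussian.integrable_id
  have h1 := (ContinuousLinearMap.proj (R := ℝ) (φ := fun _ : Fin n => ℝ) i).integral_comp_comm hi
  have h2 := mp_int (measurePreserving_eval (fun _ : Fin n => gaussianReal 0 1) i) continuous_id
  simp only [ContinuousLinearMap.proj_apply, id] at h1 h2 ⊢
  rw [← h1]
  simp only [Function.eval] at h2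
  rw [h2]; simp

lemma half_eq (n : ℕ) (i : Fin n) (ρ σ : ℝ) :
    ((Measure.pi fun _ : Fin n => gaussianReal 0 1).prod (Measure.pi fun _ : Fin n => gaussianReal 0 1)).real
      {p | p.1 i ≤ 0 ∧ (ρ • p.1 + σ • p.2) i ≤ 0} = KK ρ σ 0 0 := by
  have h1 := measurePreserving_eval (fun _ : Fin n => gaussianReal 0 1) i
  have := (h1.prod h1).measureReal_preimage (meas_set ρ σ 0 0).nullMeasurableSet
  rw [KK, ← this]
  rfl

end Bor

/-- Borell's theorem: among Borel sets of Gaussian measure 1/2, halfspaces through the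
origin maximize Gaussian noise stability. If `X, Z` are independent standard Gaussian
vectors and `Y = ρ·X + √(1-ρ²)·Z`, then for every measurable `A` with `γₙ(A) = 1/2` and
the halfspace `H = {x : x₁ ≤ 0}`, `Pr[X ∈ A ∧ Y ∈ A] ≤ Pr[X ∈ H ∧ Y ∈ H]`. -/
theorem borell_noise_stability (n : ℕ) (hn : 1 ≤ n) (ρ : ℝ) (hρ0 : 0 ≤ ρ) (hρ1 : ρ ≤ 1)
    (A : Set (Fin n → ℝ)) (hA : MeasurableSet A) (hAhalf : stdGaussian n A = 1 / 2) :
    ((stdGaussian n).prod (stdGaussian n))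
        {p : (Fin n → ℝ) × (Fin n → ℝ) |
          p.1 ∈ A ∧ (ρ • p.1 + Real.sqrt (1 - ρ ^ 2) • p.2) ∈ A} ≤
      ((stdGaussian n).prod (stdGaussian n))
        {p : (Fin n → ℝ) × (Fin n → ℝ) |
          p.1 ⟨0, hn⟩ ≤ 0 ∧ (ρ • p.1 + Real.sqrt (1 - ρ ^ 2) • p.2) ⟨0, hn⟩ ≤ 0} := by
  set μ : Measure (Fin n → ℝ) := Measure.pi fun _ : Fin n => gaussianReal 0 1 with hμ
  have e : _root_.stdGaussian n = μ := rfl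
  rw [e] at hAhalf ⊢
  set σ := Real.sqrt (1 - ρ ^ 2) with hσ
  have hA2 : μ.real A = 1 / 2 := by simp [measureReal_def, hAhalf]
  have hR := Bor.half_eq n ⟨0, hn⟩ ρ σ
  rw [← hμ] at hR
  have h1 : 0 ≤ 1 - ρ ^ 2 := by nlinarith
  have h : ρ ^ 2 + σ ^ 2 = 1 := by rw [hσ, Real.sq_sqrt h1]; ring
  rw [← ENNReal.toReal_le_toReal (measure_ne_top _ _) (measure_ne_top _ _)]
  refine le_trans ?_ hR.ge
  rcases hρ1.lt_or_eq with hlt | heq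
  · exact Bor.set_ineq (Bor.meanG n) hρ0 (Real.sqrt_pos.2 (by nlinarith)) h hA hA2
  · have hσ0 : σ = 0 := by rw [hσ, heq]; simp
    have hK : Bor.KK ρ σ 0 0 = 1 / 2 := by
      rw [heq, hσ0, ← Bor.Ph_zero, Bor.Ph,
        ← (measurePreserving_fst (μ := Bor.γ) (ν := Bor.γ)).measureReal_preimage
          measurableSet_Iic.nullMeasurableSet, Bor.KK]
      congr 1
      ext p
      simp
    rw [hK, ← hA2, ← (measurePreserving_fst (μ := μ) (ν := μ)).measureReal_preimage hA.nullMeasurableSet]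
    exact measureReal_mono (fun p hp => hp.1)
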